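/- arXiv:2012.01309 — 2 statements merged into one kernel-verified Lean document; each statement's English description precedes it below -/
import Mathlib

section
/- Let M be a finite ordered monoid. The relation ≡_KD is a monoid congruence on M, and M is in DA if and only if the quotient monoid M/≡_KD is in DA. -/
/-- Green's `R`-preorder: `s ≤_R t` iff there exists `y` with `s = t * y`. -/
def Rle {M : Type*} [Monoid M] (s t : M) : Prop := ∃ y : M, s = t * y

/-- Green's `L`-preorder: `s ≤_L t` iff there exists `x` with `s = x * t`. -/
def Lle {M : Type*} [Monoid M] (s t : M) : Prop := ∃ x : M, s = x * t

/-- Green's `R`-equivalence. -/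
def Req {M : Type*} [Monoid M] (s t : M) : Prop := Rle s t ∧ Rle t s

/-- Green's `L`-equivalence. -/
def Leq {M : Type*} [Monoid M] (s t : M) : Prop := Lle s t ∧ Lle t s

/-- The relation `u ≼_KD v`: for all `s, t`,
(i) if `s R s*v*t` then `s R s*u*t`;
(ii) if `s*v*t L t` then `s*u*t L t`;
(iii) if `s R s*v` and `v*t L t` then `s*u*t ≤ s*v*t`. -/
def PrecKD {M : Type*} [Monoid M] [PartialOrder M] (u v : M) : Prop :=
  ∀ s t : M,
    (Req s (s * v * t) → Req s (s * u * t)) ∧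
    (Leq (s * v * t) t → Leq (s * u * t) t) ∧
    (Req s (s * v) → Leq (v * t) t → s * u * t ≤ s * v * t)

/-- `u ≡_KD v` iff `u ≼_KD v` and `v ≼_KD u`. -/
def EquivKD {M : Type*} [Monoid M] [PartialOrder M] (u v : M) : Prop :=
  PrecKD u v ∧ PrecKD v u

/-- A finite monoid is in `DA` if for all `x, y, z` and every `n ≥ 1` such that
`(x*y*z)^n` is idempotent, one has `(x*y*z)^n * y * (x*y*z)^n = (x*y*z)^n`. -/
def InDA (M : Type*) [Monoid M] : Prop :=
  ∀ x y z : M, ∀ n : ℕ, 1 ≤ n → IsIdempotentElem ((x * y * z) ^ n) →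
    (x * y * z) ^ n * y * (x * y * z) ^ n = (x * y * z) ^ n

section KDCongruence

variable {M : Type*} [Monoid M]

theorem Req.of_eq {s y z : M} (h : s = s * y * z) : Req s (s * y) :=
  ⟨⟨z, h⟩, ⟨y, rfl⟩⟩

theorem Leq.of_eq {t x z : M} (h : t = z * (x * t)) : Leq (x * t) t :=
  ⟨⟨x, rfl⟩, ⟨z, h⟩⟩

theorem Req.exists_mul_eq {s a : M} (h : Req s a) : ∃ z, a * z = s :=
  let ⟨z, hz⟩ := h.1; ⟨z, hz.symm⟩

theorem Leq.exists_mul_eq {t a : M} (h : Leq a t) : ∃ z, z * a = t :=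
  let ⟨z, hz⟩ := h.2; ⟨z, hz.symm⟩

theorem PrecKD.refl [PartialOrder M] (u : M) : PrecKD u u :=
  fun _ _ => ⟨id, id, fun _ _ => le_rfl⟩

theorem PrecKD.req [PartialOrder M] {u v s : M} (h : PrecKD u v) (hs : Req s (s * v)) :
    Req s (s * u) := by
  simpa using (h s 1).1 (by simpa using hs)

theorem PrecKD.leq [PartialOrder M] {u v t : M} (h : PrecKD u v) (ht : Leq (v * t) t) :
    Leq (u * t) t := by
  simpa using (h 1 t).2.1 (by simpa using ht)

theorem PrecKD.trans [PartialOrder M] {u v w : M} (huv : PrecKD u v) (hvw : PrecKD v w) :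
    PrecKD u w := fun s t =>
  ⟨fun h => (huv s t).1 ((hvw s t).1 h), fun h => (huv s t).2.1 ((hvw s t).2.1 h),
    fun hs ht => ((huv s t).2.2 (hvw.req hs) (hvw.leq ht)).trans ((hvw s t).2.2 hs ht)⟩

theorem PrecKD.mul_mul [PartialOrder M] {u v : M} (h : PrecKD u v) (x y : M) :
    PrecKD (x * u * y) (x * v * y) := by
  intro s t
  refine ⟨fun hs => ?_, fun ht => ?_, fun hs ht => ?_⟩
  · obtain ⟨z, hz⟩ := hs.exists_mul_eq
    have key : Req (s * x) (s * x * v * (y * t)) := by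
      have := Req.of_eq (s := s * x) (y := v * (y * t)) (z := z * x)
        (by conv_lhs => rw [← hz]
            simp only [mul_assoc])
      simpa only [mul_assoc] using this
    obtain ⟨w, hw⟩ := ((h _ _).1 key).exists_mul_eq
    have := Req.of_eq (s := s) (y := x * u * y * t) (z := w * (v * y * t * z)) (by
      have hw' : s * (x * u * y * t) * (w * (v * y * t * z)) =
          (s * x * u * (y * t) * w) * (v * y * t * z) := by simp only [mul_assoc]
      rw [hw', hw]
      conv_lhs => rw [← hz]
      simp only [mul_assoc])
    simpa only [mul_assoc] using this
  · obtain ⟨z, hz⟩ := ht.exists_mul_eq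
    have key : Leq (s * x * v * (y * t)) (y * t) := by
      have := Leq.of_eq (t := y * t) (x := s * x * v) (z := y * z)
        (by conv_lhs => rw [← hz]
            simp only [mul_assoc])
      simpa only [mul_assoc] using this
    obtain ⟨w, hw⟩ := ((h _ _).2.1 key).exists_mul_eq
    have := Leq.of_eq (t := t) (x := s * (x * u * y)) (z := z * (s * x * v) * w) (by
      have hw' : z * (s * x * v) * w * (s * (x * u * y) * t) =
          z * (s * x * v) * (w * (s * x * u * (y * t))) := by simp only [mul_assoc]
      rw [hw', hw]
      conv_lhs => rw [← hz]
      simp only [mul_assoc])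
    exact this
  · obtain ⟨z, hz⟩ := hs.exists_mul_eq
    obtain ⟨w, hw⟩ := ht.exists_mul_eq
    have := (h (s * x) (y * t)).2.2
      (Req.of_eq (z := y * z * x)
        (by conv_lhs => rw [← hz]
            simp only [mul_assoc]))
      (Leq.of_eq (z := y * w * x)
        (by conv_lhs => rw [← hw]
            simp only [mul_assoc]))
    simpa only [mul_assoc] using this

theorem PrecKD.mul [PartialOrder M] {u v u' v' : M} (h : PrecKD u v) (h' : PrecKD u' v') :
    PrecKD (u * u') (v * v') := by
  have h₁ : PrecKD (u * u') (v * u') := by simpa using h.mul_mul 1 u'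
  have h₂ : PrecKD (v * u') (v * v') := by simpa using h'.mul_mul v 1
  exact h₁.trans h₂

variable (M) in
/-- The relation `≡_KD` as a monoid congruence. -/
def conKD [PartialOrder M] : Con M where
  r := EquivKD
  iseqv := ⟨fun u => ⟨.refl u, .refl u⟩, fun h => ⟨h.2, h.1⟩,
    fun h h' => ⟨h.1.trans h'.1, h'.2.trans h.2⟩⟩
  mul' h h' := ⟨h.1.mul h'.1, h.2.mul h'.2⟩

theorem exists_isIdempotentElem_pow [Finite M] (p : M) :
    ∃ k : ℕ, 1 ≤ k ∧ IsIdempotentElem (p ^ k) := by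
  obtain ⟨a, b, hab, h⟩ : ∃ a b : ℕ, a < b ∧ p ^ a = p ^ b := by
    obtain ⟨a, b, hne, h⟩ := Finite.exists_ne_map_eq_of_infinite fun n : ℕ => p ^ n
    rcases hne.lt_or_gt with hlt | hlt
    exacts [⟨a, b, hlt, h⟩, ⟨b, a, hlt, h.symm⟩]
  obtain ⟨d, rfl⟩ := Nat.exists_eq_add_of_lt hab
  have period : ∀ j i : ℕ, p ^ (a + i + (d + 1) * j) = p ^ (a + i) := by
    intro j i
    induction j with
    | zero => simp
    | succ j ih =>
      rw [← ih, show a + i + (d + 1) * (j + 1) = (a + d + 1) + (i + (d + 1) * j) by ring,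
        pow_add, ← h, ← pow_add, add_assoc a i]
  refine ⟨(d + 1) * (a + 1), Nat.mul_pos d.succ_pos a.succ_pos, ?_⟩
  have := period (a + 1) (d * (a + 1) + 1)
  rw [show a + (d * (a + 1) + 1) = (d + 1) * (a + 1) by ring] at this
  rwa [IsIdempotentElem, ← pow_add]

theorem Con.coe_pow_quotient (c : Con M) (a : M) (n : ℕ) :
    ((a ^ n : M) : c.Quotient) = (a : c.Quotient) ^ n :=
  map_pow c.mk' a n

/-- A quotient of a finite monoid in `DA` is in `DA`. -/
theorem InDA.quotient [Finite M] (hM : InDA M) (c : Con M) : InDA c.Quotient := by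
  intro x y z n hn he
  induction x using Con.induction_on with | _ x
  induction y using Con.induction_on with | _ y
  induction z using Con.induction_on with | _ z
  obtain ⟨k, hk, hidem⟩ := exists_isIdempotentElem_pow (x * y * z)
  have hpow := hM x y z (k * n) (Nat.mul_pos hk hn) (by rw [pow_mul]; exact hidem.pow n)
  have hkn : ((x : c.Quotient) * y * z) ^ (k * n) = (x * y * z) ^ n := by
    rw [mul_comm k, pow_mul]
    exact he.pow_eq (by omega)
  have := congrArg (fun a : M => (a : c.Quotient)) hpow
  simpa only [Con.coe_mul, Con.coe_pow_quotient, hkn] using this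

/-- `≡_KD` separates an idempotent `e` from every other element of the form `e * y * e`. -/
theorem EquivKD.eq_of_isIdempotentElem [PartialOrder M] {e y : M} (he : IsIdempotentElem e)
    (h : EquivKD (e * y * e) e) : e * y * e = e := by
  have hee : e * e = e := he
  have hR : Req e (e * e) := ⟨⟨e, by simp [hee]⟩, ⟨e, rfl⟩⟩
  have hL : Leq (e * e) e := ⟨⟨e, rfl⟩, ⟨e, by simp [hee]⟩⟩
  have heye : e * (e * y * e) * e = e * y * e := by
    calc e * (e * y * e) * e = e * e * y * (e * e) := by simp only [mul_assoc]
      _ = e * y * e := by rw [hee]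
  have h₁ := (h.1 e e).2.2 hR hL
  have h₂ := (h.2 e e).2.2 (h.1.req hR) (h.1.leq hL)
  rw [heye, hee, hee] at h₁ h₂
  exact le_antisymm h₁ h₂

theorem InDA.of_quotient_conKD [PartialOrder M] (h : InDA (conKD M).Quotient) : InDA M := by
  intro x y z n hn he
  refine EquivKD.eq_of_isIdempotentElem he ?_
  have := h x y z n hn (by
    have := congrArg (fun a : M => (a : (conKD M).Quotient)) (show _ * _ = _ from he)
    simpa only [IsIdempotentElem, Con.coe_mul, Con.coe_pow_quotient] using this)
  refine (Con.eq (conKD M)).1 ?_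
  simpa only [Con.coe_mul, Con.coe_pow_quotient] using this

end KDCongruence


theorem stmt6 {M : Type*} [Monoid M] [PartialOrder M] [Finite M]
    [CovariantClass M M (· * ·) (· ≤ ·)]
    [CovariantClass M M (Function.swap (· * ·)) (· ≤ ·)] :
    ∃ c : Con M, (∀ u v : M, c u v ↔ EquivKD u v) ∧ (InDA M ↔ InDA c.Quotient) := by
  exact ⟨conKD M, fun _ _ => Iff.rfl, fun h => h.quotient _, InDA.of_quotient_conKD⟩
end

section
/- Let M be a finite ordered monoid in DA, let n ≥ 1 be an integer such that s^n is idempotent for every s ∈ M, and let μ : A* → M be a monoid homomorphism from the free monoid over a finite alphabet A. Let u, v ∈ A* with alph(u) ⊆ alph(v). If for all x, y ∈ M one has (μ(v)*x)^n * μ(u) * (y*μ(v))^n ≤ (μ(v)*x)^n * μ(v) * (y*μ(v))^n, then μ(u) ≼_KD μ(v). -/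
/-- The set of letters occurring in a word. -/
def alph {A : Type*} (u : FreeMonoid A) : Set A := {a | a ∈ FreeMonoid.toList u}

theorem mul_pow_eq_self_of_mul_eq_self {M : Type*} [Monoid M] {s m : M} (h : s * m = s) (n : ℕ) :
    s * m ^ n = s := by
  induction n with
  | zero => simp
  | succ k ih => rw [pow_succ, ← mul_assoc, ih, h]

theorem pow_mul_eq_self_of_mul_eq_self {M : Type*} [Monoid M] {m t : M} (h : m * t = t) (n : ℕ) :
    m ^ n * t = t := by
  induction n with
  | zero => simp
  | succ k ih => rw [pow_succ, mul_assoc, h, ih]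

theorem FreeMonoid.exists_eq_mul_of_mul_of_mem_alph {A : Type*} {w : FreeMonoid A} {a : A}
    (ha : a ∈ alph w) : ∃ p q : FreeMonoid A, w = p * FreeMonoid.of a * q := by
  obtain ⟨l₁, l₂, h⟩ := List.append_of_mem (show a ∈ FreeMonoid.toList w from ha)
  exact ⟨FreeMonoid.ofList l₁, FreeMonoid.ofList l₂,
    FreeMonoid.toList.injective (by simp [h])⟩

theorem alph_of_mul {A : Type*} (a : A) (w : FreeMonoid A) :
    alph (FreeMonoid.of a * w) = insert a (alph w) := by
  ext b
  simp [alph]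

/-- In `DA`, if `s R s * m` then `s R s * a` for every factor `a` of `m`. -/
theorem InDA.rle_mul_of_factor {M : Type*} [Monoid M] (hDA : InDA M) {n : ℕ} (hn : 1 ≤ n)
    (hidem : ∀ s : M, IsIdempotentElem (s ^ n)) {s x a y : M} (h : Rle s (s * (x * a * y))) :
    Rle s (s * a) := by
  obtain ⟨z, hz⟩ := h
  have hs : s * (x * a * (y * z)) ^ n = s :=
    mul_pow_eq_self_of_mul_eq_self (by simpa only [mul_assoc] using hz.symm) n
  have hf := hDA x a (y * z) n hn (hidem _)
  refine ⟨(x * a * (y * z)) ^ n, ?_⟩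
  calc s = s * ((x * a * (y * z)) ^ n * a * (x * a * (y * z)) ^ n) := by rw [hf, hs]
    _ = s * a * (x * a * (y * z)) ^ n := by rw [← mul_assoc, ← mul_assoc, hs]

/-- In `DA`, if `m * t L t` then `a * t L t` for every factor `a` of `m`. -/
theorem InDA.lle_mul_of_factor {M : Type*} [Monoid M] (hDA : InDA M) {n : ℕ} (hn : 1 ≤ n)
    (hidem : ∀ s : M, IsIdempotentElem (s ^ n)) {t x a y : M} (h : Lle t (x * a * y * t)) :
    Lle t (a * t) := by
  obtain ⟨z, hz⟩ := h
  have ht : (z * x * a * y) ^ n * t = t :=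
    pow_mul_eq_self_of_mul_eq_self (by simpa only [mul_assoc] using hz.symm) n
  have hf := hDA (z * x) a y n hn (hidem _)
  refine ⟨(z * x * a * y) ^ n, ?_⟩
  calc t = (z * x * a * y) ^ n * a * (z * x * a * y) ^ n * t := by rw [hf, ht]
    _ = (z * x * a * y) ^ n * (a * t) := by rw [mul_assoc, ht, mul_assoc]

theorem InDA.rle_mul_mul {M : Type*} [Monoid M] (hDA : InDA M) {n : ℕ} (hn : 1 ≤ n)
    (hidem : ∀ s : M, IsIdempotentElem (s ^ n)) {s a b : M} (ha : Rle s (s * a))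
    (hb : Rle s (s * b)) : Rle s (s * (a * b)) := by
  obtain ⟨x, hx⟩ := ha
  obtain ⟨y, hy⟩ := hb
  have key : Rle (s * a) (s * a * (x * b * (y * a))) := ⟨1, by
    calc s * a = s * b * y * a := by rw [← hy]
      _ = s * a * x * b * y * a := by rw [← hx]
      _ = _ := by simp only [mul_assoc, mul_one]⟩
  obtain ⟨z, hz⟩ := hDA.rle_mul_of_factor hn hidem key
  refine ⟨z * x, ?_⟩
  calc s = s * a * x := hx
    _ = s * a * b * z * x := by rw [← hz]
    _ = s * (a * b) * (z * x) := by simp only [mul_assoc]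

theorem InDA.lle_mul_mul {M : Type*} [Monoid M] (hDA : InDA M) {n : ℕ} (hn : 1 ≤ n)
    (hidem : ∀ s : M, IsIdempotentElem (s ^ n)) {t a b : M} (ha : Lle t (a * t))
    (hb : Lle t (b * t)) : Lle t (a * b * t) := by
  obtain ⟨x, hx⟩ := ha
  obtain ⟨y, hy⟩ := hb
  have key : Lle (b * t) (b * x * a * y * (b * t)) := ⟨1, by
    calc b * t = b * (x * (a * t)) := by rw [← hx]
      _ = b * (x * (a * (y * (b * t)))) := by rw [← hy]
      _ = _ := by simp only [mul_assoc, one_mul]⟩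
  obtain ⟨z, hz⟩ := hDA.lle_mul_of_factor hn hidem key
  refine ⟨y * z, ?_⟩
  calc t = y * (b * t) := hy
    _ = y * (z * (a * (b * t))) := by rw [← hz]
    _ = y * z * (a * b * t) := by simp only [mul_assoc]

theorem InDA.rle_mul_map {A M : Type*} [Monoid M] (hDA : InDA M) {n : ℕ} (hn : 1 ≤ n)
    (hidem : ∀ s : M, IsIdempotentElem (s ^ n)) (μ : FreeMonoid A →* M) {s : M}
    (w : FreeMonoid A) (hw : ∀ a ∈ alph w, Rle s (s * μ (FreeMonoid.of a))) :
    Rle s (s * μ w) := by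
  induction w using FreeMonoid.inductionOn' with
  | one => exact ⟨1, by simp⟩
  | of_mul a w ih =>
    rw [alph_of_mul] at hw
    rw [map_mul]
    exact hDA.rle_mul_mul hn hidem (hw a (Set.mem_insert _ _))
      (ih fun b hb => hw b (Set.mem_insert_of_mem _ hb))

theorem InDA.lle_map_mul {A M : Type*} [Monoid M] (hDA : InDA M) {n : ℕ} (hn : 1 ≤ n)
    (hidem : ∀ s : M, IsIdempotentElem (s ^ n)) (μ : FreeMonoid A →* M) {t : M}
    (w : FreeMonoid A) (hw : ∀ a ∈ alph w, Lle t (μ (FreeMonoid.of a) * t)) :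
    Lle t (μ w * t) := by
  induction w using FreeMonoid.inductionOn' with
  | one => exact ⟨1, by simp⟩
  | of_mul a w ih =>
    rw [alph_of_mul] at hw
    rw [map_mul]
    exact hDA.lle_mul_mul hn hidem (hw a (Set.mem_insert _ _))
      (ih fun b hb => hw b (Set.mem_insert_of_mem _ hb))

theorem stmt9 {A M : Type*} [Finite A] [Monoid M] [PartialOrder M] [Finite M]
    [CovariantClass M M (· * ·) (· ≤ ·)]
    [CovariantClass M M (Function.swap (· * ·)) (· ≤ ·)]
    (hDA : InDA M) (n : ℕ) (hn : 1 ≤ n) (hidem : ∀ s : M, IsIdempotentElem (s ^ n))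
    (μ : FreeMonoid A →* M) (u v : FreeMonoid A) (halph : alph u ⊆ alph v)
    (h : ∀ x y : M,
      (μ v * x) ^ n * μ u * (y * μ v) ^ n ≤ (μ v * x) ^ n * μ v * (y * μ v) ^ n) :
    PrecKD (μ u) (μ v) := by
  refine fun s t => ⟨fun hs => ?_, fun ht => ?_, fun hs ht => ?_⟩
  · have hu : Rle s (s * μ u) := by
      refine hDA.rle_mul_map hn hidem μ u fun a ha => ?_
      obtain ⟨p, q, hv⟩ := FreeMonoid.exists_eq_mul_of_mul_of_mem_alph (halph ha)
      refine hDA.rle_mul_of_factor hn hidem (x := μ p) (y := μ q * t) ?_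
      simpa only [hv, map_mul, mul_assoc] using hs.1
    have ht : Rle s (s * t) := by
      refine hDA.rle_mul_of_factor hn hidem (x := μ v) (y := 1) ?_
      simpa only [mul_one, mul_assoc] using hs.1
    rw [mul_assoc]
    exact ⟨hDA.rle_mul_mul hn hidem hu ht, μ u * t, rfl⟩
  · have hu : Lle t (μ u * t) := by
      refine hDA.lle_map_mul hn hidem μ u fun a ha => ?_
      obtain ⟨p, q, hv⟩ := FreeMonoid.exists_eq_mul_of_mul_of_mem_alph (halph ha)
      refine hDA.lle_mul_of_factor hn hidem (x := s * μ p) (y := μ q) ?_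
      simpa only [hv, map_mul, mul_assoc] using ht.2
    have hs : Lle t (s * t) := by
      refine hDA.lle_mul_of_factor hn hidem (x := 1) (y := μ v) ?_
      simpa only [one_mul, mul_assoc] using ht.2
    exact ⟨⟨s * μ u, rfl⟩, hDA.lle_mul_mul hn hidem hs hu⟩
  · obtain ⟨x, hx⟩ := hs.1
    obtain ⟨y, hy⟩ := ht.2
    have hsx : s * (μ v * x) ^ n = s :=
      mul_pow_eq_self_of_mul_eq_self (by rw [← mul_assoc, ← hx]) n
    have hyt : (y * μ v) ^ n * t = t :=
      pow_mul_eq_self_of_mul_eq_self (by rw [mul_assoc, ← hy]) n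
    have absorb (m : M) : s * ((μ v * x) ^ n * m * (y * μ v) ^ n) * t = s * m * t := by
      rw [mul_assoc _ m, ← mul_assoc s, hsx, ← mul_assoc s, mul_assoc _ _ t, hyt]
    rw [← absorb (μ u), ← absorb (μ v)]
    exact mul_le_mul_left (mul_le_mul_right (h x y) s) t
end
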